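/- Suppose r, s > max(p, q), both r and s are coprime to pq (and ≥ 3), and r ≡ s (mod pq). Then the sets of coefficients coincide: 𝒜(p,q,r) = 𝒜(p,q,s). -/

import Mathlib

open Polynomial
open scoped Classical

/-- The defining identity of the ternary inclusion-exclusion polynomial `Q_{p,q,r}`:
`Q·(z^{qr}-1)(z^{rp}-1)(z^{pq}-1)(z-1) = (z^{pqr}-1)(z^r-1)(z^q-1)(z^p-1)`. -/
def ternaryId (p q r : ℕ) (Q : Polynomial ℤ) : Prop :=
  Q * (((X : Polynomial ℤ) ^ (q * r) - 1) * ((X : Polynomial ℤ) ^ (r * p) - 1) *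
      ((X : Polynomial ℤ) ^ (p * q) - 1) * ((X : Polynomial ℤ) - 1)) =
    ((X : Polynomial ℤ) ^ (p * q * r) - 1) * ((X : Polynomial ℤ) ^ r - 1) *
      ((X : Polynomial ℤ) ^ q - 1) * ((X : Polynomial ℤ) ^ p - 1)

/-- The coefficient `a_m` of `z^m` in `Q`, indexed by `m : ℤ`, with the convention
that `a_m = 0` for `m < 0` (and automatically `a_m = 0` for `m` beyond the degree). -/
def aCoeff (Q : Polynomial ℤ) (m : ℤ) : ℤ :=
  if 0 ≤ m then Q.coeff m.toNat else 0

/-- The characteristic function `χ` of integers representable as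
`i·qr + j·rp + k·pq` with integers `i, j, k ≥ 0`. -/
noncomputable def chi (p q r : ℕ) (n : ℤ) : ℤ :=
  if ∃ i j k : ℕ, n = (i * (q * r) + j * (r * p) + k * (p * q) : ℕ) then 1 else 0

/-- The `k`-th coefficient of `(1 + z + ⋯ + z^(p-1)) (1 - z^q) / (1 - z^(pq))`, extended
`pq`-periodically to all integers `k`, for `p < q`. -/
def blockSign (p q : ℕ) (k : ℤ) : ℤ :=
  if k % (p * q : ℤ) < p then 1
  else if (q : ℤ) ≤ k % (p * q : ℤ) ∧ k % (p * q : ℤ) < q + p then -1 else 0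

/-- The sum of `c i * g (t - r * i)` over `i < N`, where `c i` are the coefficients of the binary
inclusion-exclusion polynomial `Q_{p,q}`, written in the form
`∑_{x < a, y < b} z^(xp+yq) - z ∑_{x < q - a, y < p - b} z^(xp+yq)` with `ap + bq = pq + 1`. -/
def binarySum (p q a b : ℕ) (g : ℤ → ℤ) (r t : ℤ) (N : ℕ) : ℤ :=
  (∑ x ∈ Finset.range a, ∑ y ∈ Finset.range b,
    if x * p + y * q < N then g (t - r * (x * p + y * q : ℕ)) else 0) -
  ∑ x ∈ Finset.range (q - a), ∑ y ∈ Finset.range (p - b),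
    if x * p + y * q + 1 < N then g (t - r * (x * p + y * q + 1 : ℕ)) else 0

/-- The coefficients of the binary inclusion-exclusion polynomial `Q_{p,q}`. -/
def binaryCoeff (p q a b N : ℕ) : ℤ :=
  (∑ x ∈ Finset.range a, ∑ y ∈ Finset.range b, if x * p + y * q = N then 1 else 0) -
  ∑ x ∈ Finset.range (q - a), ∑ y ∈ Finset.range (p - b), if x * p + y * q + 1 = N then 1 else 0

/-- The binary inclusion-exclusion polynomial `Q_{p,q}`, evaluated at `z`. -/
def binaryPoly {R : Type*} [CommRing R] (p q a b : ℕ) (z : R) : R :=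
  (∑ x ∈ Finset.range a, ∑ y ∈ Finset.range b, z ^ (x * p + y * q)) -
  ∑ x ∈ Finset.range (q - a), ∑ y ∈ Finset.range (p - b), z ^ (x * p + y * q + 1)

section blockSign

variable {p q : ℕ}

theorem blockSign_congr {k l : ℤ} (h : k ≡ l [ZMOD (p * q : ℤ)]) :
    blockSign p q k = blockSign p q l := by
  unfold blockSign
  rw [h]

theorem blockSign_of_lt {k : ℤ} (h0 : 0 ≤ k) (hk : k < p * q) :
    blockSign p q k = if k < p then 1 else if (q : ℤ) ≤ k ∧ k < q + p then -1 else 0 := by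
  unfold blockSign
  rw [Int.emod_eq_of_lt h0 hk]

theorem add_lt_mul_of_three_le (hp : 3 ≤ p) (hpq : p < q) : (q + p : ℤ) < p * q := by
  have : (3 : ℤ) ≤ p := by exact_mod_cast hp
  have : (p : ℤ) < q := by exact_mod_cast hpq
  nlinarith

theorem blockSign_neg_one (hp : 3 ≤ p) (hpq : p < q) : blockSign p q (-1) = 0 := by
  have h := add_lt_mul_of_three_le hp hpq
  rw [blockSign_congr (l := p * q - 1) (by simp [Int.modEq_iff_dvd]),
    blockSign_of_lt (by omega) (by omega), if_neg (by omega), if_neg (by omega)]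

theorem blockSign_sub (hp : 3 ≤ p) (hpq : p < q) (k : ℤ) :
    blockSign p q k - blockSign p q (k - 1) =
      (if (p * q : ℤ) ∣ k then 1 else 0) - (if (p * q : ℤ) ∣ k - p then 1 else 0) -
        (if (p * q : ℤ) ∣ k - q then 1 else 0) + (if (p * q : ℤ) ∣ k - p - q then 1 else 0) := by
  have h := add_lt_mul_of_three_le hp hpq
  have key : ∀ c : ℤ, 0 ≤ c → c < p * q → ((p * q : ℤ) ∣ k - c ↔ k % (p * q : ℤ) = c) := by
    intro c h0 h1
    rw [← Int.emod_emod_of_dvd k dvd_rfl, Int.emod_emod, ← Int.modEq_iff_dvd]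
    unfold Int.ModEq
    rw [Int.emod_eq_of_lt h0 h1, eq_comm]
  have k0 := key 0 le_rfl (by omega)
  have k1 := key p (by omega) (by omega)
  have k2 := key q (by omega) (by omega)
  have k3 := key (p + q) (by omega) (by omega)
  rw [sub_zero] at k0
  rw [← sub_sub] at k3
  simp only [k0, k1, k2, k3]
  have e0 := Int.emod_nonneg k (show (p * q : ℤ) ≠ 0 by omega)
  have e1 := Int.emod_lt_of_pos k (show (0 : ℤ) < p * q by omega)
  have c0 : k ≡ k % (p * q : ℤ) [ZMOD (p * q : ℤ)] := (Int.mod_modEq _ _).symm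
  generalize k % (p * q : ℤ) = m at *
  rw [blockSign_congr c0, blockSign_of_lt e0 e1]
  rcases e0.eq_or_lt with rfl | e0
  · rw [blockSign_congr (c0.sub_right 1), zero_sub, blockSign_neg_one hp hpq]
    split_ifs <;> omega
  · rw [blockSign_congr (c0.sub_right 1), blockSign_of_lt (by omega) (by omega)]
    split_ifs <;> omega

end blockSign

section binarySum

variable {p q a b : ℕ}

theorem binarySum_zero (g : ℤ → ℤ) (r t : ℤ) : binarySum p q a b g r t 0 = 0 := by
  simp [binarySum]

theorem binarySum_succ (g : ℤ → ℤ) (r t : ℤ) (N : ℕ) :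
    binarySum p q a b g r t (N + 1) =
      binarySum p q a b g r t N + binaryCoeff p q a b N * g (t - r * N) := by
  have key : ∀ i : ℕ, (if i < N + 1 then g (t - r * (i : ℕ)) else 0) =
      (if i < N then g (t - r * (i : ℕ)) else 0) + (if i = N then 1 else 0) * g (t - r * N) := by
    intro i
    rcases lt_trichotomy i N with h | rfl | h
    · simp [h, h.ne, Nat.lt_succ_of_lt h]
    · simp
    · simp [h.not_gt, h.ne', Nat.not_lt.mpr (Nat.succ_le_of_lt h)]
  simp only [binarySum, binaryCoeff, key, Finset.sum_add_distrib, sub_mul, Finset.sum_mul]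
  ring

theorem binarySum_congr {g : ℤ → ℤ} {m : ℤ} (hg : ∀ k l, k ≡ l [ZMOD m] → g k = g l)
    {r s t u : ℤ} (hrs : r ≡ s [ZMOD m]) (htu : t ≡ u [ZMOD m]) (N : ℕ) :
    binarySum p q a b g r t N = binarySum p q a b g s u N := by
  have key (i : ℕ) : g (t - r * i) = g (u - s * i) := hg _ _ (htu.sub (hrs.mul_right _))
  simp only [binarySum, key]

theorem binarySum_eq_of_le {g : ℤ → ℤ} {r t : ℤ} {M N : ℕ} (hMN : M ≤ N)
    (h : ∀ i, M ≤ i → i < N → g (t - r * i) = 0) :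
    binarySum p q a b g r t N = binarySum p q a b g r t M := by
  induction N, hMN using Nat.le_induction with
  | base => rfl
  | succ N hN ih =>
    rw [binarySum_succ, h N hN (by omega), mul_zero, add_zero, ih fun i h1 h2 => h i h1 (by omega)]

theorem exists_of_binaryCoeff_pos {N : ℕ} (h : 0 < binaryCoeff p q a b N) :
    ∃ x < a, ∃ y < b, x * p + y * q = N := by
  by_contra! hc
  have : (∑ x ∈ Finset.range a, ∑ y ∈ Finset.range b,
      if x * p + y * q = N then (1 : ℤ) else 0) = 0 :=
    Finset.sum_eq_zero fun x hx => Finset.sum_eq_zero fun y hy =>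
      if_neg (hc x (Finset.mem_range.1 hx) y (Finset.mem_range.1 hy))
  rw [binaryCoeff, this] at h
  have : (0 : ℤ) ≤ ∑ x ∈ Finset.range (q - a), ∑ y ∈ Finset.range (p - b),
      if x * p + y * q + 1 = N then 1 else 0 := by positivity
  omega

theorem exists_of_binaryCoeff_neg {N : ℕ} (h : binaryCoeff p q a b N < 0) :
    ∃ x < q - a, ∃ y < p - b, x * p + y * q + 1 = N := by
  by_contra! hc
  have : (∑ x ∈ Finset.range (q - a), ∑ y ∈ Finset.range (p - b),
      if x * p + y * q + 1 = N then (1 : ℤ) else 0) = 0 :=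
    Finset.sum_eq_zero fun x hx => Finset.sum_eq_zero fun y hy =>
      if_neg (hc x (Finset.mem_range.1 hx) y (Finset.mem_range.1 hy))
  rw [binaryCoeff, this] at h
  have : (0 : ℤ) ≤ ∑ x ∈ Finset.range a, ∑ y ∈ Finset.range b,
      if x * p + y * q = N then 1 else 0 := by positivity
  omega

/-- If `up + vq = 1` then `u ≡ a (mod q)` and `v ≡ b (mod p)`. -/
theorem exists_eq_add_mul_of_mul_add_mul_eq_one (hpq : p.Coprime q)
    (hab : a * p + b * q = p * q + 1) {u v : ℤ} (huv : u * p + v * q = 1) :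
    ∃ c d : ℤ, u = a + q * c ∧ v = b + p * d := by
  have hco : IsCoprime (p : ℤ) q := Nat.isCoprime_iff_coprime.2 hpq
  have hab' : (a * p + b * q : ℤ) = p * q + 1 := by exact_mod_cast hab
  obtain ⟨c, hc⟩ : (q : ℤ) ∣ u - a :=
    hco.symm.dvd_of_dvd_mul_right ⟨b - v - p, by linear_combination huv - hab'⟩
  obtain ⟨d, hd⟩ : (p : ℤ) ∣ v - b :=
    hco.dvd_of_dvd_mul_right ⟨a - u - q, by linear_combination huv - hab'⟩
  exact ⟨c, d, by linarith, by linarith⟩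

theorem binaryCoeff_mul_succ_nonpos (hpq : p.Coprime q) (haq : a < q) (hbp : b < p)
    (hab : a * p + b * q = p * q + 1) (N : ℕ) :
    binaryCoeff p q a b N * binaryCoeff p q a b (N + 1) ≤ 0 := by
  have hab' : (a * p + b * q : ℤ) = p * q + 1 := by exact_mod_cast hab
  by_contra! h
  rcases pos_and_pos_or_neg_and_neg_of_mul_pos h with ⟨h1, h2⟩ | ⟨h1, h2⟩
  · obtain ⟨x, hx, y, hy, e⟩ := exists_of_binaryCoeff_pos h1
    obtain ⟨x', hx', y', hy', e'⟩ := exists_of_binaryCoeff_pos h2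
    have e1 : (x * p + y * q : ℤ) = N := by exact_mod_cast e
    have e2 : (x' * p + y' * q : ℤ) = N + 1 := by exact_mod_cast e'
    obtain ⟨c, d, hc, hd⟩ := exists_eq_add_mul_of_mul_add_mul_eq_one hpq hab
      (u := x' - x) (v := y' - y) (by linear_combination e2 - e1)
    have hc1 : c = -1 := by
      have : c < 0 := by nlinarith
      have : -2 < c := by nlinarith
      omega
    have hd1 : d = -1 := by
      have : d < 0 := by nlinarith
      have : -2 < d := by nlinarith
      omega
    subst hc1 hd1
    have : (p * q : ℤ) = 0 := by linear_combination e1 - e2 + p * hc + q * hd + hab'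
    have : (0 : ℤ) < p * q := by
      have : 0 < p * q := Nat.mul_pos (by omega) (by omega)
      exact_mod_cast this
    omega
  · obtain ⟨x, hx, y, hy, e⟩ := exists_of_binaryCoeff_neg h1
    obtain ⟨x', hx', y', hy', e'⟩ := exists_of_binaryCoeff_neg h2
    have e1 : (x * p + y * q + 1 : ℤ) = N := by exact_mod_cast e
    have e2 : (x' * p + y' * q + 1 : ℤ) = N + 1 := by exact_mod_cast e'
    obtain ⟨c, d, hc, hd⟩ := exists_eq_add_mul_of_mul_add_mul_eq_one hpq hab
      (u := x' - x) (v := y' - y) (by linear_combination e2 - e1)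
    have hxq : (x' : ℤ) < q - a := by omega
    have hxq' : (x : ℤ) < q - a := by omega
    have hyp : (y' : ℤ) < p - b := by omega
    have hyp' : (y : ℤ) < p - b := by omega
    have hc1 : c = 0 := by
      have : c < 1 := by nlinarith only [hc, hxq]
      have : -1 < c := by nlinarith only [hc, hxq']
      omega
    have hd1 : d = 0 := by
      have : d < 1 := by nlinarith only [hd, hyp]
      have : -1 < d := by nlinarith only [hd, hyp']
      omega
    subst hc1 hd1
    have : (p * q : ℤ) = 0 := by linear_combination e2 - e1 - p * hc - q * hd - hab'
    have : (0 : ℤ) < p * q := by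
      have : 0 < p * q := Nat.mul_pos (by omega) (by omega)
      exact_mod_cast this
    omega

end binarySum

section jump

variable {p q a b : ℕ}

/-- Modulo `q`, the congruence `t ≡ u x` has a unique solution `x` in `[0, q)`. -/
theorem exists_lt_forall_dvd_iff {q : ℕ} (hq : 0 < q) {u : ℤ} (hu : IsCoprime u q) (t : ℤ) :
    ∃ ξ < q, ∀ x : ℤ, (q : ℤ) ∣ t - u * x ↔ (q : ℤ) ∣ x - ξ := by
  obtain ⟨v, w, hvw⟩ := hu
  have hq' : (0 : ℤ) < q := by exact_mod_cast hq
  have h0 := Int.emod_nonneg (v * t) hq'.ne'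
  have h1 := Int.emod_lt_of_pos (v * t) hq'
  have h2 := Int.emod_add_mul_ediv (v * t) q
  refine ⟨((v * t) % q).toNat, by omega, fun x => ?_⟩
  rw [Int.toNat_of_nonneg h0]
  generalize v * t % q = m at *
  generalize v * t / q = d at *
  constructor
  · rintro ⟨c, hc⟩
    exact ⟨d + w * x - v * c, by linear_combination -v * hc - x * hvw - h2⟩
  · rintro ⟨c, hc⟩
    exact ⟨w * t - u * c + u * d, by linear_combination -u * hc - t * hvw - u * h2⟩

theorem natCast_dvd_natCast_sub_iff {q x y : ℕ} (hx : x < q) (hy : y < q) :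
    (q : ℤ) ∣ (x : ℤ) - y ↔ x = y := by
  constructor
  · intro h
    have := Int.eq_zero_of_abs_lt_dvd h (by rw [abs_lt]; omega)
    omega
  · rintro rfl
    simp

theorem sum_range_sum_range_ite_eq (f : ℕ → ℕ → ℤ) (m n k l : ℕ) :
    (∑ x ∈ Finset.range m, ∑ y ∈ Finset.range n, if x = k ∧ y = l then f x y else 0) =
      if k < m ∧ l < n then f k l else 0 := by
  simp [ite_and, Finset.sum_ite_eq']

/-- The truncated sum of binary coefficients over the single residue class `i ≡ t / r (mod pq)`
only sees the solution `(ξ, η)` of `t ≡ r (ξ p + η q) (mod pq)`. -/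
theorem binarySum_dvd_eq (hpq : p.Coprime q) (haq : a < q) (hbp : b < p)
    (hab : a * p + b * q = p * q + 1) {r t : ℤ} {ξ η : ℕ} (hξ : ξ < q) (hη : η < p)
    (hx : ∀ x : ℤ, (q : ℤ) ∣ t - r * p * x ↔ (q : ℤ) ∣ x - ξ)
    (hy : ∀ y : ℤ, (p : ℤ) ∣ t - r * q * y ↔ (p : ℤ) ∣ y - η) (N : ℕ) :
    binarySum p q a b (fun k => if (p * q : ℤ) ∣ k then 1 else 0) r t N =
      if ξ < a ∧ η < b then (if ξ * p + η * q < N then 1 else 0)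
      else if a ≤ ξ ∧ b ≤ η then (if ξ * p + η * q < N + p * q then -1 else 0) else 0 := by
  have hco : IsCoprime (p : ℤ) q := Nat.isCoprime_iff_coprime.2 hpq
  have hab' : (a * p + b * q : ℤ) = p * q + 1 := by exact_mod_cast hab
  have key (x y : ℤ) :
      (p * q : ℤ) ∣ t - r * (x * p + y * q) ↔ (q : ℤ) ∣ x - ξ ∧ (p : ℤ) ∣ y - η := by
    rw [← hx, ← hy, ← dvd_sub_left (a := (q : ℤ)) (b := t - r * p * x) (c := r * y * q)
      (dvd_mul_left _ _), ← dvd_sub_left (a := (p : ℤ)) (b := t - r * q * y) (c := r * x * p)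
      (dvd_mul_left _ _), show t - r * p * x - r * y * q = t - r * (x * p + y * q) by ring,
      show t - r * q * y - r * x * p = t - r * (x * p + y * q) by ring]
    exact ⟨fun h => ⟨(dvd_mul_left _ _).trans h, (dvd_mul_right _ _).trans h⟩,
      fun h => hco.mul_dvd h.2 h.1⟩
  have e1 : (∑ x ∈ Finset.range a, ∑ y ∈ Finset.range b, if x * p + y * q < N then
      (if (p * q : ℤ) ∣ t - r * (x * p + y * q : ℕ) then (1 : ℤ) else 0) else 0) =
      if ξ < a ∧ η < b then (if ξ * p + η * q < N then 1 else 0) else 0 := by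
    rw [← sum_range_sum_range_ite_eq (fun x y => if x * p + y * q < N then 1 else 0)]
    refine Finset.sum_congr rfl fun x hx => Finset.sum_congr rfl fun y hy => ?_
    rw [Finset.mem_range] at hx hy
    have := key x y
    rw [natCast_dvd_natCast_sub_iff (by omega) hξ, natCast_dvd_natCast_sub_iff (by omega) hη]
      at this
    push_cast
    simp only [this]
    split_ifs <;> rfl
  have e2 : (∑ x ∈ Finset.range (q - a), ∑ y ∈ Finset.range (p - b), if x * p + y * q + 1 < N then
      (if (p * q : ℤ) ∣ t - r * (x * p + y * q + 1 : ℕ) then (1 : ℤ) else 0) else 0) =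
      if a ≤ ξ ∧ b ≤ η then (if ξ * p + η * q < N + p * q then 1 else 0) else 0 := by
    by_cases h : a ≤ ξ ∧ b ≤ η
    · obtain ⟨x₀, rfl⟩ := Nat.exists_eq_add_of_le h.1
      obtain ⟨y₀, rfl⟩ := Nat.exists_eq_add_of_le h.2
      have e0 : (a + x₀) * p + (b + y₀) * q = x₀ * p + y₀ * q + 1 + p * q := by
        linear_combination hab
      rw [if_pos h, e0]
      simp only [Nat.add_lt_add_iff_right]
      trans if x₀ < q - a ∧ y₀ < p - b then (if x₀ * p + y₀ * q + 1 < N then (1 : ℤ) else 0) else 0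
      · rw [← sum_range_sum_range_ite_eq (fun x y => if x * p + y * q + 1 < N then 1 else 0)]
        refine Finset.sum_congr rfl fun x hx => Finset.sum_congr rfl fun y hy => ?_
        rw [Finset.mem_range] at hx hy
        have := key (x + a : ℕ) (y + b : ℕ)
        rw [natCast_dvd_natCast_sub_iff (by omega) hξ, natCast_dvd_natCast_sub_iff (by omega) hη,
          ← dvd_add_left (a := (p * q : ℤ)) (c := r * (p * q)) (dvd_mul_left _ _),
          show t - r * ((x + a : ℕ) * p + (y + b : ℕ) * q) + r * (p * q) =
            t - r * (x * p + y * q + 1 : ℕ) by push_cast; linear_combination -r * hab'] at this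
        simp only [this]
        have e3 : x + a = a + x₀ ↔ x = x₀ := by omega
        have e4 : y + b = b + y₀ ↔ y = y₀ := by omega
        simp only [e3, e4]
        split_ifs <;> rfl
      · rw [if_pos (by omega)]
    · rw [if_neg h]
      refine Finset.sum_eq_zero fun x hx => Finset.sum_eq_zero fun y hy => ?_
      rw [Finset.mem_range] at hx hy
      have := key (x + a : ℕ) (y + b : ℕ)
      rw [natCast_dvd_natCast_sub_iff (by omega) hξ, natCast_dvd_natCast_sub_iff (by omega) hη,
        ← dvd_add_left (a := (p * q : ℤ)) (c := r * (p * q)) (dvd_mul_left _ _),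
        show t - r * ((x + a : ℕ) * p + (y + b : ℕ) * q) + r * (p * q) =
          t - r * (x * p + y * q + 1 : ℕ) by push_cast; linear_combination -r * hab'] at this
      rw [if_neg (c := (p * q : ℤ) ∣ _) (by rw [this]; omega), ite_self]
  rw [binarySum, e1, e2]
  split_ifs <;> first | rfl | omega

theorem abs_binarySum_sub_le_one (hp : 3 ≤ p) (hlt : p < q) (hpq : p.Coprime q) (haq : a < q)
    (hbp : b < p) (hab : a * p + b * q = p * q + 1) {r : ℤ} (hr : IsCoprime r (p * q : ℤ))
    (t : ℤ) (N : ℕ) :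
    |binarySum p q a b (blockSign p q) r t N - binarySum p q a b (blockSign p q) r (t - 1) N|
      ≤ 1 := by
  have hco : IsCoprime (p : ℤ) q := Nat.isCoprime_iff_coprime.2 hpq
  have hrp : IsCoprime (r * p) (q : ℤ) := hr.of_mul_right_right.mul_left hco
  have hrq : IsCoprime (r * q) (p : ℤ) := hr.of_mul_right_left.mul_left hco.symm
  obtain ⟨x₁, hx₁, hx₁'⟩ := exists_lt_forall_dvd_iff (by omega) hrp t
  obtain ⟨x₂, hx₂, hx₂'⟩ := exists_lt_forall_dvd_iff (by omega) hrp (t - p)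
  obtain ⟨y₁, hy₁, hy₁'⟩ := exists_lt_forall_dvd_iff (by omega) hrq t
  obtain ⟨y₂, hy₂, hy₂'⟩ := exists_lt_forall_dvd_iff (by omega) hrq (t - q)
  have hx₃ (x : ℤ) : (q : ℤ) ∣ t - q - r * p * x ↔ (q : ℤ) ∣ x - x₁ := by
    rw [← hx₁', sub_right_comm, dvd_sub_left dvd_rfl]
  have hx₄ (x : ℤ) : (q : ℤ) ∣ t - p - q - r * p * x ↔ (q : ℤ) ∣ x - x₂ := by
    rw [← hx₂', sub_right_comm, dvd_sub_left dvd_rfl]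
  have hy₃ (y : ℤ) : (p : ℤ) ∣ t - p - r * q * y ↔ (p : ℤ) ∣ y - y₁ := by
    rw [← hy₁', sub_right_comm, dvd_sub_left dvd_rfl]
  have hy₄ (y : ℤ) : (p : ℤ) ∣ t - p - q - r * q * y ↔ (p : ℤ) ∣ y - y₂ := by
    rw [← hy₂', sub_right_comm t, sub_right_comm _ (p : ℤ), dvd_sub_left dvd_rfl]
  have split : binarySum p q a b (blockSign p q) r t N -
      binarySum p q a b (blockSign p q) r (t - 1) N =
      binarySum p q a b (fun k => if (p * q : ℤ) ∣ k then 1 else 0) r t N -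
      binarySum p q a b (fun k => if (p * q : ℤ) ∣ k then 1 else 0) r (t - p) N -
      binarySum p q a b (fun k => if (p * q : ℤ) ∣ k then 1 else 0) r (t - q) N +
      binarySum p q a b (fun k => if (p * q : ℤ) ∣ k then 1 else 0) r (t - p - q) N := by
    have key (i : ℕ) : blockSign p q (t - r * i) = blockSign p q (t - 1 - r * i) +
        (if (p * q : ℤ) ∣ t - r * i then 1 else 0) - (if (p * q : ℤ) ∣ t - p - r * i then 1 else 0) -
        (if (p * q : ℤ) ∣ t - q - r * i then 1 else 0) +
        (if (p * q : ℤ) ∣ t - p - q - r * i then 1 else 0) := by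
      have := blockSign_sub hp hlt (t - r * i)
      rw [show t - 1 - r * i = t - r * i - 1 by ring, show t - p - r * i = t - r * i - p by ring,
        show t - q - r * i = t - r * i - q by ring,
        show t - p - q - r * i = t - r * i - p - q by ring]
      linear_combination this
    have ite_key (c : Prop) [Decidable c] (u v w x y : ℤ) : (if c then u + v - w - x + y else 0) =
        (if c then u else 0) + (if c then v else 0) - (if c then w else 0) -
          (if c then x else 0) + (if c then y else 0) := by
      split_ifs <;> simp
    simp only [binarySum, key, ite_key, Finset.sum_add_distrib, Finset.sum_sub_distrib]
    ring
  rw [split, binarySum_dvd_eq hpq haq hbp hab hx₁ hy₁ hx₁' hy₁',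
    binarySum_dvd_eq hpq haq hbp hab hx₂ hy₁ hx₂' hy₃,
    binarySum_dvd_eq hpq haq hbp hab hx₁ hy₂ hx₃ hy₂',
    binarySum_dvd_eq hpq haq hbp hab hx₂ hy₂ hx₄ hy₄]
  generalize x₁ * p = u₁
  generalize x₂ * p = u₂
  generalize y₁ * q = v₁
  generalize y₂ * q = v₂
  generalize p * q = m
  rw [abs_le]
  rcases lt_or_ge x₁ a with h1 | h1 <;> rcases lt_or_ge x₂ a with h2 | h2 <;>
    rcases lt_or_ge y₁ b with h3 | h3 <;> rcases lt_or_ge y₂ b with h4 | h4 <;>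
    simp only [h1, h2, h3, h4, not_lt_of_ge, not_le_of_gt, and_self, and_true, and_false, if_true,
      if_false] <;>
    omega

end jump

section binaryPoly

variable {p q a b : ℕ}

theorem sum_sum_pow_mul {R : Type*} [CommRing R] (z : R) (m n : ℕ) :
    (∑ x ∈ Finset.range m, ∑ y ∈ Finset.range n, z ^ (x * p + y * q)) *
      ((z ^ p - 1) * (z ^ q - 1)) = (z ^ (m * p) - 1) * (z ^ (n * q) - 1) := by
  have h1 := geom_sum_mul (z ^ p) m
  have h2 := geom_sum_mul (z ^ q) n
  simp only [← pow_mul, mul_comm p, mul_comm q] at h1 h2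
  simp only [pow_add, ← Finset.mul_sum, ← Finset.sum_mul]
  rw [← h1, ← h2]
  ring

theorem binaryPoly_mul {R : Type*} [CommRing R] (z : R) (haq : a ≤ q) (hbp : b ≤ p)
    (hab : a * p + b * q = p * q + 1) :
    binaryPoly p q a b z * ((z ^ p - 1) * (z ^ q - 1)) = (z ^ (p * q) - 1) * (z - 1) := by
  have hbq : 1 ≤ b * q := by nlinarith
  obtain ⟨m, hm⟩ := Nat.exists_eq_add_of_le' hbq
  have hap : 1 ≤ a * p := by nlinarith
  obtain ⟨n, hn⟩ := Nat.exists_eq_add_of_le' hap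
  have h1 : (q - a) * p = m := by rw [Nat.sub_mul, mul_comm q p]; omega
  have h2 : (p - b) * q = n := by rw [Nat.sub_mul]; omega
  have h3 : p * q = n + m + 1 := by omega
  have e1 := sum_sum_pow_mul (p := p) (q := q) z a b
  have e2 := sum_sum_pow_mul (p := p) (q := q) z (q - a) (p - b)
  rw [hm, hn] at e1
  rw [h1, h2] at e2
  simp only [binaryPoly, pow_succ _ (_ + _ : ℕ), ← Finset.sum_mul]
  rw [sub_mul, e1, mul_right_comm, e2, h3]
  ring

end binaryPoly

section powerSeries

variable {p q a b : ℕ}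

theorem mk_blockSign_mul (hp : 3 ≤ p) (hlt : p < q) :
    PowerSeries.mk (fun n => blockSign p q n) *
      (((PowerSeries.X : PowerSeries ℤ) ^ (p * q) - 1) * (PowerSeries.X - 1)) =
      (PowerSeries.X ^ p - 1) * (PowerSeries.X ^ q - 1) := by
  have h := add_lt_mul_of_three_le hp hlt
  have h' : q + p < p * q := by exact_mod_cast h
  have e1 : PowerSeries.mk (fun n => blockSign p q n) * (1 - PowerSeries.X) =
      PowerSeries.mk (fun n => blockSign p q n - blockSign p q (n - 1)) := by
    ext n
    rw [mul_sub, mul_one, map_sub]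
    cases n with
    | zero => simp [blockSign_neg_one hp hlt]
    | succ n => simp [PowerSeries.coeff_succ_mul_X]
  have e2 : PowerSeries.mk (fun n => blockSign p q n - blockSign p q (n - 1)) *
      (1 - PowerSeries.X ^ (p * q)) =
      1 - PowerSeries.X ^ p - PowerSeries.X ^ q + PowerSeries.X ^ (p + q) := by
    ext n
    rw [mul_sub, mul_one, map_sub, PowerSeries.coeff_mul_X_pow']
    simp only [PowerSeries.coeff_mk, map_add, map_sub, PowerSeries.coeff_X_pow,
      PowerSeries.coeff_one]
    rcases le_or_gt (p * q) n with hn | hn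
    · rw [if_pos hn, Nat.cast_sub hn, Nat.cast_mul, sub_right_comm (n : ℤ) (p * q : ℤ),
        blockSign_congr (k := n) (l := n - p * q) (by simp [Int.modEq_iff_dvd]),
        blockSign_congr (k := n - 1) (l := n - 1 - p * q) (by simp [Int.modEq_iff_dvd])]
      rw [sub_self, if_neg (by omega), if_neg (by omega), if_neg (by omega), if_neg (by omega)]
      rfl
    · have key : ∀ c : ℕ, c < p * q → ((p * q : ℤ) ∣ (n : ℤ) - c ↔ n = c) := fun c hc => by
        exact_mod_cast natCast_dvd_natCast_sub_iff (q := p * q) hn hc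
      have k0 := key 0 (by omega)
      have k1 := key p (by omega)
      have k2 := key q (by omega)
      have k3 := key (p + q) (by omega)
      rw [Nat.cast_zero, sub_zero] at k0
      rw [Nat.cast_add, ← sub_sub] at k3
      rw [if_neg hn.not_ge, blockSign_sub hp hlt]
      simp only [k0, k1, k2, k3, sub_zero]
  rw [← e1] at e2
  linear_combination e2

theorem powerSeries_X_pow_sub_one_ne_zero {n : ℕ} (hn : n ≠ 0) :
    (PowerSeries.X : PowerSeries ℤ) ^ n - 1 ≠ 0 := by
  intro h
  have := congrArg (PowerSeries.coeff 0) h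
  simp [hn] at this

theorem ternaryId.coe_eq (hp : 3 ≤ p) (hlt : p < q) (haq : a ≤ q) (hbp : b ≤ p)
    (hab : a * p + b * q = p * q + 1) {r : ℕ} (hr : 0 < r) {Q : Polynomial ℤ}
    (hQ : ternaryId p q r Q) :
    (Q : PowerSeries ℤ) = binaryPoly p q a b (PowerSeries.X ^ r) *
      PowerSeries.mk (fun n => blockSign p q n) := by
  have h1 := congrArg (fun P : Polynomial ℤ => (P : PowerSeries ℤ)) hQ
  simp only [Polynomial.coe_mul, Polynomial.coe_sub, Polynomial.coe_pow, Polynomial.coe_X,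
    Polynomial.coe_one] at h1
  have h2 := binaryPoly_mul ((PowerSeries.X : PowerSeries ℤ) ^ r) haq hbp hab
  simp only [← pow_mul] at h2
  have h3 := mk_blockSign_mul hp hlt
  have h0 : (((PowerSeries.X : PowerSeries ℤ) ^ (q * r) - 1) * (PowerSeries.X ^ (r * p) - 1) *
      (PowerSeries.X ^ (p * q) - 1) * (PowerSeries.X - 1)) ≠ 0 := by
    have hX := powerSeries_X_pow_sub_one_ne_zero one_ne_zero
    rw [pow_one] at hX
    refine mul_ne_zero (mul_ne_zero (mul_ne_zero ?_ ?_) ?_) hX <;>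
      exact powerSeries_X_pow_sub_one_ne_zero (Nat.mul_ne_zero (by omega) (by omega))
  refine mul_right_cancel₀ h0 (h1.trans ?_)
  rw [mul_comm r (p * q), mul_comm r q] at h2
  linear_combination -(PowerSeries.X ^ q - 1) * (PowerSeries.X ^ p - 1) * h2 -
    binaryPoly p q a b ((PowerSeries.X : PowerSeries ℤ) ^ r) * (PowerSeries.X ^ (q * r) - 1) *
      (PowerSeries.X ^ (r * p) - 1) * h3

theorem ternaryId.coeff_eq (hp : 3 ≤ p) (hlt : p < q) (haq : a ≤ q) (hbp : b ≤ p)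
    (hab : a * p + b * q = p * q + 1) {r : ℕ} (hr : 0 < r) {Q : Polynomial ℤ}
    (hQ : ternaryId p q r Q) (n : ℕ) :
    Q.coeff n = binarySum p q a b (blockSign p q) r n (n / r + 1) := by
  have key (i : ℕ) : PowerSeries.coeff n ((PowerSeries.X ^ r) ^ i *
      PowerSeries.mk (fun n => blockSign p q n)) =
      if i < n / r + 1 then blockSign p q (n - r * i) else 0 := by
    simp only [← pow_mul, PowerSeries.coeff_X_pow_mul', Nat.lt_succ_iff, Nat.le_div_iff_mul_le hr,
      mul_comm i]
    split_ifs with h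
    · rw [PowerSeries.coeff_mk, Nat.cast_sub h, Nat.cast_mul]
    · rfl
  rw [← Polynomial.coeff_coe, hQ.coe_eq hp hlt haq hbp hab hr, binaryPoly, sub_mul, map_sub]
  simp only [Finset.sum_mul, map_sum, key, binarySum]

theorem ternaryId.natDegree_eq (hp : 3 ≤ p) (hq : 3 ≤ q) {r : ℕ} (hr : 3 ≤ r) {Q : Polynomial ℤ}
    (hQ : ternaryId p q r Q) : Q.natDegree = (p - 1) * (q - 1) * (r - 1) := by
  have hne {n : ℕ} (hn : 0 < n) : (X : Polynomial ℤ) ^ n - 1 ≠ 0 := X_pow_sub_C_ne_zero hn 1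
  have hdeg (n : ℕ) : ((X : Polynomial ℤ) ^ n - 1).natDegree = n := natDegree_X_pow_sub_C (r := 1)
  have hne1 : (X : Polynomial ℤ) - 1 ≠ 0 := by simpa using hne one_pos
  have hdeg1 : ((X : Polynomial ℤ) - 1).natDegree = 1 := by simpa using hdeg 1
  have h1 := hne (n := q * r) (by positivity)
  have h2 := hne (n := r * p) (by positivity)
  have h3 := hne (n := p * q) (by positivity)
  have h4 := hne (n := p * q * r) (by positivity)
  have h5 := hne (n := r) (by positivity)
  have h6 := hne (n := q) (by positivity)
  have h7 := hne (n := p) (by positivity)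
  unfold ternaryId at hQ
  have hQ0 : Q ≠ 0 := by
    rintro rfl
    rw [zero_mul] at hQ
    exact mul_ne_zero (mul_ne_zero (mul_ne_zero h4 h5) h6) h7 hQ.symm
  have h := congrArg natDegree hQ
  rw [natDegree_mul hQ0 (mul_ne_zero (mul_ne_zero (mul_ne_zero h1 h2) h3) hne1),
    natDegree_mul (mul_ne_zero (mul_ne_zero h1 h2) h3) hne1, natDegree_mul (mul_ne_zero h1 h2) h3,
    natDegree_mul h1 h2, natDegree_mul (mul_ne_zero (mul_ne_zero h4 h5) h6) h7,
    natDegree_mul (mul_ne_zero h4 h5) h6, natDegree_mul h4 h5, hdeg1] at h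
  simp only [hdeg] at h
  obtain ⟨p, rfl⟩ := Nat.exists_eq_add_of_le' (show 1 ≤ p by omega)
  obtain ⟨q, rfl⟩ := Nat.exists_eq_add_of_le' (show 1 ≤ q by omega)
  obtain ⟨r, rfl⟩ := Nat.exists_eq_add_of_le' (show 1 ≤ r by omega)
  simp only [Nat.add_sub_cancel]
  linarith

end powerSeries

section coefficientSet

variable {p q a b : ℕ}

theorem exists_eq_of_abs_sub_le_one {f : ℕ → ℤ} (hf : ∀ n, |f (n + 1) - f n| ≤ 1) {i j : ℕ} {v : ℤ}
    (hi : f i ≤ v) (hj : v ≤ f j) : ∃ n, f n = v := by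
  have key : ∀ g : ℕ → ℤ, (∀ n, |g (n + 1) - g n| ≤ 1) → ∀ i j, i ≤ j → ∀ w, g i ≤ w → w ≤ g j →
      ∃ n, g n = w := by
    intro g hg i j hij w hi
    induction j, hij using Nat.le_induction with
    | base => exact fun hj => ⟨i, le_antisymm hi hj⟩
    | succ j _ ih =>
      intro hj
      have := abs_le.1 (hg j)
      rcases le_or_gt w (g j) with h | h
      · exact ih h
      · exact ⟨j + 1, by omega⟩
  rcases le_total i j with h | h
  · exact key f hf i j h v hi hj
  · obtain ⟨n, hn⟩ := key (fun n => -f n) (fun n => by rw [← abs_neg]; convert hf n using 2; ring)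
      j i h (-v) (neg_le_neg hj) (neg_le_neg hi)
    exact ⟨n, neg_injective hn⟩

/-- Consecutive coefficients of a ternary inclusion-exclusion polynomial differ by at most one. -/
theorem abs_binarySum_succ_sub_le_one (hp : 3 ≤ p) (hlt : p < q) (hpq : p.Coprime q) (haq : a < q)
    (hbp : b < p) (hab : a * p + b * q = p * q + 1) {r : ℕ}
    (hrc : IsCoprime (r : ℤ) (p * q : ℤ)) (n : ℕ) :
    |binarySum p q a b (blockSign p q) r (n + 1 : ℕ) ((n + 1) / r + 1) -
      binarySum p q a b (blockSign p q) r n (n / r + 1)| ≤ 1 := by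
  have h := abs_binarySum_sub_le_one hp hlt hpq haq hbp hab hrc (n + 1 : ℕ) ((n + 1) / r + 1)
  rw [Nat.cast_succ, add_sub_cancel_right] at h
  rw [Nat.cast_succ]
  convert h using 3
  rw [Nat.succ_div]
  split_ifs with hd
  · have e : (n : ℤ) - r * (n / r + 1 : ℕ) = -1 := by
      have h1 := Nat.succ_div_of_dvd hd
      have h2 := Nat.mul_div_cancel' hd
      rw [h1] at h2
      have h3 : (r : ℤ) * (n / r + 1 : ℕ) = n + 1 := by exact_mod_cast h2
      omega
    rw [binarySum_succ _ _ _ (n / r + 1), e, blockSign_neg_one hp hlt, mul_zero, add_zero]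
  · rfl

theorem binarySum_one_self (hp : 3 ≤ p) (hlt : p < q) (r : ℤ) :
    binarySum p q a b (blockSign p q) r p 1 = 0 := by
  have h := add_lt_mul_of_three_le hp hlt
  rw [← zero_add 1, binarySum_succ, binarySum_zero, Nat.cast_zero, mul_zero, sub_zero,
    blockSign_of_lt (by omega) (by omega), if_neg (by omega), if_neg (by omega), mul_zero, zero_add]

theorem exists_binarySum_div_eq (hp : 3 ≤ p) (hlt : p < q) (hpq : p.Coprime q) (haq : a < q)
    (hbp : b < p) (hab : a * p + b * q = p * q + 1) {r : ℕ} (hr : q < r)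
    (hrc : IsCoprime (r : ℤ) (p * q : ℤ)) (t : ℤ) (N : ℕ) :
    ∃ n : ℕ, binarySum p q a b (blockSign p q) r n (n / r + 1) =
      binarySum p q a b (blockSign p q) r t N := by
  have hlt' := add_lt_mul_of_three_le hp hlt
  have hzero : ∃ n : ℕ, binarySum p q a b (blockSign p q) r n (n / r + 1) = 0 :=
    ⟨p, by rw [Nat.div_eq_of_lt (by omega), zero_add, binarySum_one_self hp hlt]⟩
  cases N with
  | zero => rwa [binarySum_zero]
  | succ N =>
    obtain ⟨j, hj, hjt⟩ : ∃ j : ℕ, (j : ℤ) < p * q ∧ (r * N + j : ℕ) ≡ t [ZMOD (p * q : ℤ)] := by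
      have h0 := Int.emod_nonneg (t - r * N) (show (p * q : ℤ) ≠ 0 by omega)
      refine ⟨((t - r * N) % (p * q : ℤ)).toNat, ?_, ?_⟩
      · rw [Int.toNat_of_nonneg h0]
        exact Int.emod_lt_of_pos _ (by omega)
      · push_cast
        rw [Int.toNat_of_nonneg h0]
        calc _ ≡ r * N + (t - r * N) [ZMOD (p * q : ℤ)] := (Int.mod_modEq _ _).add_left _
          _ = t := by ring
    rw [← binarySum_congr (fun _ _ => blockSign_congr) (Int.ModEq.refl (r : ℤ)) hjt]
    obtain ⟨n, hn⟩ : ∃ n, n = r * N + j := ⟨_, rfl⟩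
    rw [← hn]
    have hn' : (n : ℤ) = r * N + j := by exact_mod_cast hn
    obtain ⟨M, hMN, hM, n₁, hn₁⟩ : ∃ M ≤ N, (n : ℤ) - r * M < p * q ∧ ∃ n₁ : ℕ,
        binarySum p q a b (blockSign p q) r n₁ (n₁ / r + 1) =
        binarySum p q a b (blockSign p q) r n M := by
      rcases lt_or_ge n (p * q) with h | h
      · exact ⟨0, Nat.zero_le _, by rw [Nat.cast_zero, mul_zero, sub_zero]; exact_mod_cast h,
          by rwa [binarySum_zero]⟩
      · obtain ⟨n₁, rfl⟩ := Nat.exists_eq_add_of_le' h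
        refine ⟨n₁ / r + 1, ?_, ?_, n₁, ?_⟩
        · rw [Nat.succ_le_iff, Nat.div_lt_iff_lt_mul (by omega), mul_comm]
          zify
          push_cast at hn'
          omega
        · have := Nat.lt_mul_div_succ n₁ (show 0 < r by omega)
          zify at this
          push_cast
          omega
        · exact binarySum_congr (fun _ _ => blockSign_congr) (Int.ModEq.refl (r : ℤ))
            (by simp [Int.modEq_iff_dvd]) _
    have hvanish : ∀ L, M ≤ L → r * (L + 1) ≤ n →
        binarySum p q a b (blockSign p q) r n L = binarySum p q a b (blockSign p q) r n M := by
      refine fun L hL hLn => binarySum_eq_of_le hL fun i hi1 hi2 => ?_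
      have h1 : (r : ℤ) * M ≤ r * i := by gcongr
      have h2 : (r : ℤ) * (i + 2) ≤ n := by
        have : r * (i + 2) ≤ r * (L + 1) := Nat.mul_le_mul_left r (by omega)
        exact_mod_cast this.trans hLn
      rw [mul_add] at h2
      rw [blockSign_of_lt (by omega) (by omega), if_neg (by omega), if_neg (by omega)]
    rcases lt_or_ge n (r * (N + 1)) with h1 | h1
    · have : n / r = N := Nat.div_eq_of_lt_le (by rw [mul_comm]; omega) (by rwa [mul_comm])
      exact ⟨n, by rw [this]⟩
    rcases lt_or_ge n (r * (N + 1 + 1)) with h2 | h2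
    · have hdiv : n / r = N + 1 :=
        Nat.div_eq_of_lt_le (by rwa [mul_comm]) (by rwa [mul_comm])
      have hv := binarySum_succ (p := p) (q := q) (a := a) (b := b) (blockSign p q) r n N
      have hw := binarySum_succ (p := p) (q := q) (a := a) (b := b) (blockSign p q) r n (N + 1)
      rw [hvanish N hMN h1] at hv
      zify at h1 h2
      simp only [mul_add, mul_one] at h1 h2
      have e : (n : ℤ) - r * (N + 1 : ℕ) = j - r := by push_cast; linarith
      rw [e] at hw
      rw [show (n : ℤ) - r * N = j by linarith, blockSign_of_lt (by omega) hj,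
        if_neg (by omega)] at hv
      split_ifs at hv with h
      · rw [blockSign_of_lt (by omega) (by omega), if_pos (by omega)] at hw
        have hc := binaryCoeff_mul_succ_nonpos hpq haq hbp hab N
        have hstep := abs_binarySum_succ_sub_le_one hp hlt hpq haq hbp hab hrc
        have hn₂ : binarySum p q a b (blockSign p q) r n (n / r + 1) =
            binarySum p q a b (blockSign p q) r n (N + 1 + 1) := by rw [hdiv]
        rw [hv] at hw ⊢
        rw [hw] at hn₂
        rcases mul_nonpos_iff.1 hc |>.symm with ⟨c1, c2⟩ | ⟨c1, c2⟩
        · refine exists_eq_of_abs_sub_le_one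
            (f := fun n : ℕ => binarySum p q a b (blockSign p q) r n (n / r + 1)) hstep
            (i := n₁) (j := n) ?_ ?_
          · exact hn₁.trans_le (by linarith)
          · exact (by linarith : _ ≤ _).trans_eq hn₂.symm
        · refine exists_eq_of_abs_sub_le_one
            (f := fun n : ℕ => binarySum p q a b (blockSign p q) r n (n / r + 1)) hstep
            (i := n) (j := n₁) ?_ ?_
          · exact hn₂.trans_le (by linarith)
          · exact (by linarith : _ ≤ _).trans_eq hn₁.symm
      · exact ⟨n₁, by rw [hn₁, hv, mul_zero, add_zero]⟩
    · exact ⟨n₁, by rw [hn₁, hvanish (N + 1) (by omega) h2]⟩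

theorem exists_mul_add_mul_eq (hp : 1 < p) (hq : 1 < q) (hpq : p.Coprime q) :
    ∃ a b : ℕ, a < q ∧ b < p ∧ a * p + b * q = p * q + 1 := by
  obtain ⟨a, haq, ha⟩ := Nat.exists_mul_mod_eq_one_of_coprime hpq hq
  have h := Nat.div_add_mod (p * a) q
  rw [ha] at h
  generalize p * a / q = c at h
  have hc0 : c ≠ 0 := by
    rintro rfl
    rw [mul_zero, zero_add, eq_comm] at h
    exact hp.ne' (Nat.eq_one_of_mul_eq_one_right h)
  have hcp : c < p := by
    by_contra! hcp
    nlinarith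
  refine ⟨a, p - c, haq, by omega, ?_⟩
  obtain ⟨d, rfl⟩ := Nat.exists_eq_add_of_le hcp.le
  rw [Nat.add_sub_cancel_left]
  linarith

/-- The coefficients of `Q_{p,q,r}` are all the truncated sums, which only depend on `r` modulo
`pq`. -/
theorem ternaryId.coeff_set_eq (hp : 3 ≤ p) (hlt : p < q) (hpq : p.Coprime q) (haq : a < q)
    (hbp : b < p) (hab : a * p + b * q = p * q + 1) {r : ℕ} (hr : q < r)
    (hrc : r.Coprime (p * q)) {Q : Polynomial ℤ} (hQ : ternaryId p q r Q) :
    {v : ℤ | ∃ m ≤ (p - 1) * (q - 1) * (r - 1), Q.coeff m = v} =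
      {v : ℤ | ∃ (t : ℤ) (N : ℕ), binarySum p q a b (blockSign p q) r t N = v} := by
  have hrc' : IsCoprime (r : ℤ) (p * q : ℤ) := by exact_mod_cast Nat.isCoprime_iff_coprime.2 hrc
  have hcoeff := hQ.coeff_eq hp hlt haq.le hbp.le hab (by omega)
  ext v
  constructor
  · rintro ⟨m, -, rfl⟩
    exact ⟨m, m / r + 1, (hcoeff m).symm⟩
  · rintro ⟨t, N, rfl⟩
    obtain ⟨n, hn⟩ := exists_binarySum_div_eq hp hlt hpq haq hbp hab hr hrc' t N
    rw [← hcoeff] at hn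
    rcases le_or_gt n ((p - 1) * (q - 1) * (r - 1)) with h | h
    · exact ⟨n, h, hn⟩
    · rw [← hQ.natDegree_eq hp (by omega) (by omega)] at h
      rw [coeff_eq_zero_of_natDegree_lt h] at hn
      refine ⟨p, ?_, ?_⟩
      · calc p ≤ 1 * 1 * (r - 1) := by omega
          _ ≤ _ := by gcongr <;> omega
      · rw [hcoeff, Nat.div_eq_of_lt (by omega), zero_add, binarySum_one_self hp hlt, hn]

theorem ternaryId.coeff_set_eq_of_modEq (hp : 3 ≤ p) (hlt : p < q) (hpq : p.Coprime q) {r s : ℕ}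
    (hr : q < r) (hs : q < s) (hrc : r.Coprime (p * q)) (hsc : s.Coprime (p * q))
    (hmod : r ≡ s [MOD p * q]) {Qr Qs : Polynomial ℤ} (hQr : ternaryId p q r Qr)
    (hQs : ternaryId p q s Qs) :
    {v : ℤ | ∃ m ≤ (p - 1) * (q - 1) * (r - 1), Qr.coeff m = v} =
      {v : ℤ | ∃ m ≤ (p - 1) * (q - 1) * (s - 1), Qs.coeff m = v} := by
  obtain ⟨a, b, haq, hbp, hab⟩ := exists_mul_add_mul_eq (by omega) (by omega) hpq
  have hmod' : (r : ℤ) ≡ s [ZMOD (p * q : ℤ)] := by exact_mod_cast Int.natCast_modEq_iff.2 hmod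
  rw [hQr.coeff_set_eq hp hlt hpq haq hbp hab hr hrc, hQs.coeff_set_eq hp hlt hpq haq hbp hab hs hsc]
  simp only [binarySum_congr (fun _ _ => blockSign_congr) hmod' (Int.ModEq.refl _)]

end coefficientSet

theorem ternaryId.swap {p q r : ℕ} {Q : Polynomial ℤ} (h : ternaryId p q r Q) :
    ternaryId q p r Q := by
  unfold ternaryId at *
  rw [mul_comm p r, mul_comm r q, mul_comm q p]
  linear_combination h

/-- If `r, s > max(p,q)` and `r ≡ s (mod pq)`, then `𝒜(p,q,r) = 𝒜(p,q,s)`. -/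
theorem stmt_5 (p q r s : ℕ) (hp : 3 ≤ p) (hq : 3 ≤ q) (hr3 : 3 ≤ r) (hs3 : 3 ≤ s)
    (hpq : Nat.Coprime p q) (hrc : Nat.Coprime r (p * q)) (hsc : Nat.Coprime s (p * q))
    (hrmax : max p q < r) (hsmax : max p q < s)
    (hmod : r ≡ s [MOD p * q])
    (Qr Qs : Polynomial ℤ) (hQr : ternaryId p q r Qr) (hQs : ternaryId p q s Qs) :
    {a : ℤ | ∃ m ≤ (p - 1) * (q - 1) * (r - 1), Qr.coeff m = a} =
      {a : ℤ | ∃ m ≤ (p - 1) * (q - 1) * (s - 1), Qs.coeff m = a} := by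
  rw [max_lt_iff] at hrmax hsmax
  rcases lt_trichotomy p q with h | rfl | h
  · exact hQr.coeff_set_eq_of_modEq hp h hpq hrmax.2 hsmax.2 hrc hsc hmod hQs
  · rw [Nat.coprime_self] at hpq
    omega
  · rw [mul_comm p q] at hrc hsc hmod
    rw [mul_comm (p - 1) (q - 1)]
    exact hQr.swap.coeff_set_eq_of_modEq hq h hpq.symm hrmax.1 hsmax.1 hrc hsc hmod hQs.swap
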